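/- arXiv:2212.02752 — 3 statements merged into one kernel-verified Lean document; each statement's English description precedes it below -/
import Mathlib

section
/- Let λ ∈ ℝ, β ∈ [0,1), ρ ∈ (0,1], and let V : ℝ^N → ℝ be concave on Ω. Then the active set A_λ = { X ∈ Ω : β·ρ·( V(TX) − Σ_{i=1}^N X_i·V(T_i) ) ≥ λ } is a convex subset of ℝ^N. (This set is exactly {X ∈ Ω : r(X) ≥ a(X)} where a(X) = λ + βρΣ_i X_i V(T_i) + β(1−ρ)V(TX) is the active function and r(X) = βV(TX) is the passive function, so the optimal policy of the single bandit problem is a convex-sampling policy.) -/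
open Matrix

theorem Matrix.mulVec_mem_stdSimplex {m n : Type*} [Fintype m] [Fintype n]
    {T : Matrix m n ℝ} (hT : ∀ j, (fun i => T i j) ∈ stdSimplex ℝ m)
    {X : n → ℝ} (hX : X ∈ stdSimplex ℝ n) : T *ᵥ X ∈ stdSimplex ℝ m := by
  have h : T *ᵥ X = ∑ j, X j • fun i => T i j := by
    ext i
    simp [Matrix.mulVec, dotProduct, mul_comm]
  rw [h]
  exact (convex_stdSimplex ℝ m).sum_mem (fun j _ => hX.1 j) hX.2 fun j _ => hT j

/-- The active set A_λ = {X ∈ Ω : βρ(V(TX) − Σ_i X_i V(T_i)) ≥ λ} of the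
single bandit problem is convex when the value function V is concave on Ω. -/
theorem active_set_convex {N : ℕ} (hN : 1 ≤ N)
    (lam β ρ : ℝ) (hβ : 0 ≤ β ∧ β < 1) (hρ : 0 < ρ ∧ ρ ≤ 1)
    (T : Matrix (Fin N) (Fin N) ℝ)
    (hT : ∀ j, (fun i => T i j) ∈ stdSimplex ℝ (Fin N))
    (V : (Fin N → ℝ) → ℝ)
    (hV : ConcaveOn ℝ (stdSimplex ℝ (Fin N)) V) :
    Convex ℝ {X : Fin N → ℝ | X ∈ stdSimplex ℝ (Fin N) ∧
      lam ≤ β * ρ * (V (T *ᵥ X) - ∑ i, X i * V (fun k => T k i))} := by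
  have hcomp : ConcaveOn ℝ (stdSimplex ℝ (Fin N)) fun X => V (T *ᵥ X) :=
    (hV.comp_linearMap T.mulVecLin).subset
      (fun _ hX => Matrix.mulVec_mem_stdSimplex hT hX) (convex_stdSimplex ℝ _)
  have hlin : ConvexOn ℝ (stdSimplex ℝ (Fin N))
      fun X : Fin N → ℝ => ∑ i, X i * V (fun k => T k i) := by
    refine ⟨convex_stdSimplex ℝ _, fun X _ Y _ a b _ _ _ => le_of_eq ?_⟩
    simp only [Pi.add_apply, Pi.smul_apply, smul_eq_mul, Finset.mul_sum,
      ← Finset.sum_add_distrib]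
    exact Finset.sum_congr rfl fun i _ => by ring
  exact ((hcomp.sub hlin).smul (mul_nonneg hβ.1 hρ.1.le)).convex_ge lam
end

section
/- Let ι be a nonempty finite index set, let a, b : ι → ℝ, and define g : ℝ → ℝ by g(λ) = min_{i∈ι} ( a(i) + b(i)·λ ). Fix y ∈ ℝ and let S = { i ∈ ι : a(i) + b(i)·y = g(y) } (which is nonempty). Then g has a right derivative at y (the derivative of g within [y,∞) at y) equal to min_{i∈S} b(i), and a left derivative at y (the derivative of g within (−∞,y] at y) equal to max_{i∈S} b(i). -/
/-- If, among the affine functions attaining the minimum at `y`, the `i`-th one is the smallest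
throughout `s`, then the pointwise minimum has derivative `b i` within `s` at `y`. -/
theorem hasDerivWithinAt_iInf_affine {ι : Type*} [Finite ι] {a b : ι → ℝ} {y : ℝ} {s : Set ℝ}
    {i : ι} (hi : a i + b i * y = ⨅ j, (a j + b j * y))
    (hs : ∀ j, a j + b j * y = ⨅ k, (a k + b k * y) →
      ∀ x ∈ s, b i * (x - y) ≤ b j * (x - y)) :
    HasDerivWithinAt (fun x : ℝ => ⨅ j, (a j + b j * x)) (b i) s y := by
  have : Nonempty ι := ⟨i⟩
  have hbdd (x : ℝ) : BddBelow (Set.range fun j => a j + b j * x) := (Set.finite_range _).bddBelow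
  have hle : ∀ᶠ x in nhdsWithin y s, ∀ j, a i + b i * x ≤ a j + b j * x := by
    refine Filter.eventually_all.2 fun j => ?_
    by_cases hj : a j + b j * y = ⨅ k, (a k + b k * y)
    · filter_upwards [self_mem_nhdsWithin] with x hx
      linarith [hs j hj x hx]
    · have hlt : a i + b i * y < a j + b j * y :=
        hi.trans_lt (lt_of_le_of_ne (ciInf_le (hbdd y) j) (Ne.symm hj))
      have hev : ∀ᶠ x in nhds y, a i + b i * x < a j + b j * x :=
        ContinuousAt.eventually_lt (by fun_prop) (by fun_prop) hlt
      exact (hev.filter_mono nhdsWithin_le_nhds).mono fun x hx => hx.le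
  have hderiv : HasDerivWithinAt (fun x : ℝ => a i + b i * x) (b i) s y := by
    simpa using (((hasDerivAt_id y).const_mul (b i)).const_add (a i)).hasDerivWithinAt (s := s)
  refine hderiv.congr_of_eventuallyEq ?_ hi.symm
  filter_upwards [hle] with x hx
  exact le_antisymm (ciInf_le (hbdd x) i) (le_ciInf hx)

/-- Abstract form of Lemma 5(3): the pointwise minimum g of finitely many affine
functions λ ↦ a i + b i·λ has, at any point y, a right derivative equal to the
minimum slope among the functions active at y, and a left derivative equal to
the maximum active slope. -/
theorem min_affine_one_sided_derivs {ι : Type*} [Fintype ι] [Nonempty ι]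
    (a b : ι → ℝ) (y : ℝ) :
    ({i : ι | a i + b i * y = ⨅ j, (a j + b j * y)} : Set ι).Nonempty ∧
    HasDerivWithinAt (fun lam : ℝ => ⨅ j, (a j + b j * lam))
      (sInf (b '' {i : ι | a i + b i * y = ⨅ j, (a j + b j * y)}))
      (Set.Ici y) y ∧
    HasDerivWithinAt (fun lam : ℝ => ⨅ j, (a j + b j * lam))
      (sSup (b '' {i : ι | a i + b i * y = ⨅ j, (a j + b j * y)}))
      (Set.Iic y) y := by
  set S := {i : ι | a i + b i * y = ⨅ j, (a j + b j * y)}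
  have hS : S.Nonempty := exists_eq_ciInf_of_finite
  have hfin : (b '' S).Finite := Set.toFinite _
  refine ⟨hS, ?_, ?_⟩
  · obtain ⟨i, hi, hib⟩ := (hS.image b).csInf_mem hfin
    rw [← hib]
    refine hasDerivWithinAt_iInf_affine hi fun j hj x hx => ?_
    exact mul_le_mul_of_nonneg_right
      (hib.trans_le (csInf_le hfin.bddBelow (Set.mem_image_of_mem b hj))) (sub_nonneg.2 hx)
  · obtain ⟨i, hi, hib⟩ := (hS.image b).csSup_mem hfin
    rw [← hib]
    refine hasDerivWithinAt_iInf_affine hi fun j hj x hx => ?_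
    exact mul_le_mul_of_nonpos_right
      ((le_csSup hfin.bddAbove (Set.mem_image_of_mem b hj)).trans_eq hib.symm) (sub_nonpos.2 hx)
end

section
/- Let P and Q be row-stochastic matrices on the same nonempty finite index set, let β ∈ [0,1), let σ, b ≥ 0, and let c, c', V, φ be vectors satisfying V = c + β·P·V and φ = c' + β·Q·φ. If |c_x − c'_x| ≤ σ for every index x and |((P−Q)·V)_x| ≤ b for every index x, then |V_x − φ_x| ≤ (σ + β·b)/(1−β) for every index x. -/
open Matrix

/-- A row-stochastic matrix does not increase a uniform bound on the entries of a vector. -/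
theorem abs_mulVec_le_of_row_stochastic {m n : Type*} [Fintype n] {Q : Matrix m n ℝ}
    (hQ0 : ∀ i j, 0 ≤ Q i j) (hQ1 : ∀ i, ∑ j, Q i j = 1) {v : n → ℝ} {r : ℝ}
    (hv : ∀ j, |v j| ≤ r) (i : m) : |(Q *ᵥ v) i| ≤ r :=
  calc |∑ j, Q i j * v j| ≤ ∑ j, |Q i j * v j| := Finset.abs_sum_le_sum_abs _ _
    _ ≤ ∑ j, Q i j * r := Finset.sum_le_sum fun j _ => by
        rw [abs_mul, abs_of_nonneg (hQ0 i j)]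
        exact mul_le_mul_of_nonneg_left (hv j) (hQ0 i j)
    _ = r := by rw [← Finset.sum_mul, hQ1, one_mul]

/-- Perturbation bound (engine of Theorem 2): if V = c + βPV and φ = c' + βQφ
for row-stochastic P, Q, with |c − c'| ≤ σ entrywise and |(P−Q)V| ≤ b
entrywise, then |V − φ| ≤ (σ + βb)/(1−β) entrywise. -/
theorem value_perturbation_bound {n : Type*} [Fintype n] [Nonempty n]
    (P Q : Matrix n n ℝ)
    (hP0 : ∀ i j, 0 ≤ P i j) (hP1 : ∀ i, ∑ j, P i j = 1)
    (hQ0 : ∀ i j, 0 ≤ Q i j) (hQ1 : ∀ i, ∑ j, Q i j = 1)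
    (β σ b : ℝ) (hβ : 0 ≤ β ∧ β < 1) (hσ : 0 ≤ σ) (hb : 0 ≤ b)
    (c c' V φ : n → ℝ)
    (hV : V = c + β • (P *ᵥ V)) (hφ : φ = c' + β • (Q *ᵥ φ))
    (hcc : ∀ x, |c x - c' x| ≤ σ)
    (hPQ : ∀ x, |((P - Q) *ᵥ V) x| ≤ b) :
    ∀ x, |V x - φ x| ≤ (σ + β * b) / (1 - β) := by
  obtain ⟨hβ0, hβ1⟩ := hβ
  obtain ⟨y, hy⟩ := Finite.exists_max fun x => |V x - φ x|
  have hQy := abs_mulVec_le_of_row_stochastic hQ0 hQ1 (v := V - φ) hy y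
  have hdiff : V y - φ y =
      (c y - c' y) + β * ((P - Q) *ᵥ V) y + β * (Q *ᵥ (V - φ)) y := by
    have hVy := congrFun hV y
    have hφy := congrFun hφ y
    simp only [Pi.add_apply, Pi.smul_apply, smul_eq_mul] at hVy hφy
    simp only [sub_mulVec, mulVec_sub, Pi.sub_apply]
    linear_combination hVy - hφy
  have hle : |V y - φ y| ≤ σ + β * b + β * |V y - φ y| :=
    calc |V y - φ y|
        ≤ |c y - c' y| + |β * ((P - Q) *ᵥ V) y| + |β * (Q *ᵥ (V - φ)) y| := by
          rw [hdiff]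
          exact abs_add_three _ _ _
      _ ≤ σ + β * b + β * |V y - φ y| := by
          rw [abs_mul, abs_mul, abs_of_nonneg hβ0]
          gcongr
          exacts [hcc y, hPQ y]
  intro x
  refine (hy x).trans ?_
  rw [le_div_iff₀ (sub_pos.mpr hβ1)]
  linarith
end
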